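/- Let T ⊆ M be nonempty, let Q be a set of monoid projections on M, and let I be a radical order ideal of M. Assume that every subset T₀ ⊆ T with card T₀ < κ(Q[T], I) is Q-bounded in T (i.e. κ(Q[T],I) ≤ Δ_Q(T)). Then there exists f₀ ∈ T such that for every Q ∈ Q: Q(f₀) ∈ I if and only if Q(f) ∈ I for all f ∈ T. In particular, if Q = {T_g : g ∈ M} is the set of all translates, then T has a ≥_I-greatest element: some f₀ ∈ T with f₀ ≥_I f for all f ∈ T. -/

import Mathlib

open Cardinal

/-- A positively ordered (p.o.) monoid. -/
class POMonoid (M : Type*) extends CommMonoid M, PartialOrder M, OrderBot M where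
  le_one : ∀ f : M, f ≤ 1
  mul_le_mul_of_le : ∀ {f g : M}, f ≤ g → ∀ h : M, f * h ≤ g * h

/-- An order ideal: downward closed set. -/
def IsOrderIdeal {M : Type*} [POMonoid M] (I : Set M) : Prop :=
  ∀ f ∈ I, ∀ g : M, g ≤ f → g ∈ I

/-- A radical set: `f ∈ I` whenever `f ^ n ∈ I` for some `n ≥ 1`. -/
def IsRadicalSet {M : Type*} [POMonoid M] (I : Set M) : Prop :=
  ∀ f : M, ∀ n : ℕ, 1 ≤ n → f ^ n ∈ I → f ∈ I

/-- `D` is mutually `I`-disjoint. -/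
def MutuallyDisjointMod {M : Type*} [POMonoid M] (I D : Set M) : Prop :=
  D ∩ I = ∅ ∧ ∀ f ∈ D, ∀ g ∈ D, f ≠ g → f * g ∈ I

/-- `κ(T, I)`. -/
noncomputable def kappa {M : Type*} [POMonoid M] (T I : Set M) : Cardinal :=
  sInf {c : Cardinal | ∀ D : Set M, D ⊆ T → MutuallyDisjointMod I D → #D < c}

/-- A monoid projection. -/
def IsMonoidProjection {M : Type*} [POMonoid M] (Q : M → M) : Prop :=
  Monotone Q ∧ (∀ f : M, Q f ≤ f) ∧ ∀ f g : M, f * Q g ≤ Q (f * g)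

/-- `𝒬[T]`. -/
def projImage {M : Type*} [POMonoid M] (𝒬 : Set (M → M)) (T : Set M) : Set M :=
  {h : M | ∃ Q ∈ 𝒬, ∃ f ∈ T, Q f = h}

/-- `h` is a `π`-bound in `T` for `T₀`: `h ∈ T` and
`π_h[T₀] ⊆ I(π̄[T])`, i.e. each `π_h f`, `f ∈ T₀`, lies below some diagonal
value `π_g g` with `g ∈ T`. -/
def IsPiBound {M : Type*} [POMonoid M] (π : M → M → M) (T T₀ : Set M)
    (h : M) : Prop :=
  h ∈ T ∧ ∀ f ∈ T₀, ∃ g ∈ T, π h f ≤ π g g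

/-- `T₀` is `𝒬`-bounded in `T`: every `𝒬`-direction admits a bound. -/
def QBounded {M : Type*} [POMonoid M] (𝒬 : Set (M → M)) (T T₀ : Set M) : Prop :=
  ∀ π : M → M → M, (∀ h : M, π h ∈ 𝒬) → ∃ h : M, IsPiBound π T T₀ h

/-- The set of translates `T_g : f ↦ g * f`. -/
def translates (M : Type*) [POMonoid M] : Set (M → M) :=
  {Q : M → M | ∃ g : M, Q = fun f => g * f}

/-- The preorder `f ≥_I g`. -/
def geMod {M : Type*} [POMonoid M] (I : Set M) (f g : M) : Prop :=
  ∀ h : M, f * h ∈ I → g * h ∈ I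

/-- The cardinality of a mutually `I`-disjoint subset of `T` is below `κ(T, I)`. -/
theorem mk_lt_kappa {M : Type*} [POMonoid M] {T I D : Set M} (hDT : D ⊆ T)
    (hD : MutuallyDisjointMod I D) : #D < kappa T I :=
  csInf_mem (s := {c : Cardinal | ∀ D : Set M, D ⊆ T → MutuallyDisjointMod I D → #D < c})
    ⟨Order.succ #M, fun D _ _ => Order.lt_succ_of_le (mk_set_le D)⟩ D hDT hD

/-- Every set `S` has a maximal mutually `I`-disjoint subset `D`: an element of `S` outside `I`
that is `I`-disjoint from all of `D` already lies in `D`. -/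
theorem exists_maximal_mutuallyDisjointMod {M : Type*} [POMonoid M] (S I : Set M) :
    ∃ D ⊆ S, MutuallyDisjointMod I D ∧
      ∀ x ∈ S, x ∉ I → (∀ d ∈ D, d * x ∈ I) → x ∈ D := by
  obtain ⟨D, hD⟩ := zorn_subset {D : Set M | D ⊆ S ∧ MutuallyDisjointMod I D} (by
    intro c hc hchain
    refine ⟨⋃₀ c, ⟨Set.sUnion_subset fun s hs => (hc hs).1, ?_, ?_⟩,
      fun s hs => Set.subset_sUnion_of_mem hs⟩
    · refine Set.eq_empty_of_forall_notMem fun x hx => ?_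
      obtain ⟨⟨s, hs, hxs⟩, hxI⟩ := hx
      exact (hc hs).2.1.subset ⟨hxs, hxI⟩
    · rintro x ⟨s, hs, hxs⟩ y ⟨u, hu, hyu⟩ hxy
      rcases hchain.total hs hu with hsu | hus
      · exact (hc hu).2.2 x (hsu hxs) y hyu hxy
      · exact (hc hs).2.2 x hxs y (hus hyu) hxy)
  refine ⟨D, hD.prop.1, hD.prop.2, fun x hxS hxI hx => ?_⟩
  refine hD.le_of_ge (y := insert x D) ⟨Set.insert_subset hxS hD.prop.1, ?_, ?_⟩
    (Set.subset_insert x D) (Set.mem_insert x D)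
  · rw [Set.insert_inter_of_notMem hxI, hD.prop.2.1]
  · rintro y (rfl | hy) z (rfl | hz) hyz
    · exact absurd rfl hyz
    · exact mul_comm z y ▸ hx z hz
    · exact hx y hy
    · exact hD.prop.2.2 y hy z hz hyz

/-- A monoid projection satisfies `g * Q f ≤ Q g`. -/
theorem IsMonoidProjection.mul_apply_le {M : Type*} [POMonoid M] {Q : M → M}
    (hQ : IsMonoidProjection Q) (g f : M) : g * Q f ≤ Q g := by
  refine (hQ.2.2 g f).trans (hQ.1 ?_)
  simpa [mul_comm] using POMonoid.mul_le_mul_of_le (POMonoid.le_one f) g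

/-- Under the directedness assumption `κ(𝒬[T], I) ≤ Δ_𝒬(T)` there is a single
element `f₀ ∈ T` testing the projection problem; when `𝒬` is the set of
translates, `T` has a `≥_I`-greatest element. -/
theorem stmt14 {M : Type*} [POMonoid M] (T : Set M) (hTne : T.Nonempty)
    (𝒬 : Set (M → M)) (h𝒬 : ∀ Q ∈ 𝒬, IsMonoidProjection Q) (I : Set M)
    (hord : IsOrderIdeal I) (hrad : IsRadicalSet I)
    (hdir : ∀ T₀ : Set M, T₀ ⊆ T → #T₀ < kappa (projImage 𝒬 T) I →
      QBounded 𝒬 T T₀) :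
    (∃ f₀ ∈ T, ∀ Q ∈ 𝒬, (Q f₀ ∈ I ↔ ∀ f ∈ T, Q f ∈ I)) ∧
      (𝒬 = translates M → ∃ f₀ ∈ T, ∀ f ∈ T, geMod I f₀ f) := by
  have hfirst : ∃ f₀ ∈ T, ∀ Q ∈ 𝒬, (Q f₀ ∈ I ↔ ∀ f ∈ T, Q f ∈ I) := by
    by_contra hcon
    have hbad : ∀ h ∈ T, ∃ Q ∈ 𝒬, Q h ∈ I ∧ ∃ f ∈ T, Q f ∉ I := by
      intro h hh
      by_contra hne
      refine hcon ⟨h, hh, fun Q hQ => ⟨fun hQh f hf => ?_, fun hall => hall h hh⟩⟩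
      by_contra hQf
      exact hne ⟨Q, hQ, hQh, f, hf, hQf⟩
    obtain ⟨t, ht⟩ := hTne
    obtain ⟨Q₀, hQ₀, -⟩ := hbad t ht
    have hdirection : ∀ h : M, ∃ Q ∈ 𝒬, h ∈ T → Q h ∈ I ∧ ∃ f ∈ T, Q f ∉ I := by
      intro h
      by_cases hh : h ∈ T
      · obtain ⟨Q, hQ, hQh⟩ := hbad h hh
        exact ⟨Q, hQ, fun _ => hQh⟩
      · exact ⟨Q₀, hQ₀, fun hh' => absurd hh' hh⟩
    choose π hπ𝒬 hπ using hdirection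
    obtain ⟨D, hDS, hD, hDmax⟩ := exists_maximal_mutuallyDisjointMod (projImage 𝒬 T) I
    choose Q hQ f hf hQf using fun d : D => hDS d.2
    obtain ⟨h, hhT, hbound⟩ := hdir (Set.range f) (Set.range_subset_iff.2 hf)
      (mk_range_le.trans_lt (mk_lt_kappa hDS hD)) π hπ𝒬
    obtain ⟨-, f', hf', hnot⟩ := hπ h hhT
    have hdisj : ∀ d ∈ D, d * π h f' ∈ I := by
      intro d hd
      obtain ⟨g, hg, hle⟩ := hbound (f ⟨d, hd⟩) (Set.mem_range_self _)
      have hdf : d ≤ f ⟨d, hd⟩ :=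
        (hQf ⟨d, hd⟩).symm.trans_le ((h𝒬 _ (hQ ⟨d, hd⟩)).2.1 _)
      exact hord _ (hord _ (hπ g hg).1 _ hle) _
        ((POMonoid.mul_le_mul_of_le hdf _).trans ((h𝒬 _ (hπ𝒬 h)).mul_apply_le _ _))
    have hmem : π h f' ∈ D :=
      hDmax _ ⟨π h, hπ𝒬 h, f', hf', rfl⟩ hnot hdisj
    refine hnot (hrad _ 2 one_le_two ?_)
    rw [pow_two]
    exact hdisj _ hmem
  refine ⟨hfirst, fun h𝒬eq => ?_⟩
  obtain ⟨f₀, hf₀, htest⟩ := hfirst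
  refine ⟨f₀, hf₀, fun f hf h hmem => ?_⟩
  have htrans : (fun x => h * x) ∈ 𝒬 := h𝒬eq ▸ ⟨h, rfl⟩
  rw [mul_comm] at hmem ⊢
  exact (htest _ htrans).1 hmem f hf
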